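/- Suppose the data contain at least one interior group (1 ≤ k_y ≤ k), let u > 0 with k_y ≥ u + 1, and suppose the k_y×m matrix X_y whose rows are the covariate vectors of the interior groups satisfies rank(X_y) = m. Then ∫_{ℝ^m} ∫_0^∞ r^{−(u+1)} · L(r, β) dr dβ < ∞, i.e., the posterior under the fully improper joint hyper-prior dβ dr/r^{u+1} is proper. -/

import Mathlib

open MeasureTheory Real Filter Finset

/-- The Beta function `B(a,b) = ∫₀¹ v^(a-1) (1-v)^(b-1) dv`. -/
noncomputable def betaFn (a b : ℝ) : ℝ :=
  ∫ v in (0:ℝ)..1, v ^ (a - 1) * (1 - v) ^ (b - 1)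

/-- The standard logistic function `σ(t) = exp t / (1 + exp t)`. -/
noncomputable def logistic (t : ℝ) : ℝ := Real.exp t / (1 + Real.exp t)

/-- Expected random effect `p_j^E(β) = σ(x_jᵀ β)`. -/
noncomputable def pE {k m : ℕ} (x : Fin k → Fin m → ℝ) (j : Fin k) (β : Fin m → ℝ) : ℝ :=
  logistic (∑ i, x j i * β i)

/-- The Beta-Binomial likelihood
`L(r,β) = ∏ⱼ C(nⱼ,yⱼ) B(yⱼ + r pⱼᴱ, nⱼ - yⱼ + r qⱼᴱ) / B(r pⱼᴱ, r qⱼᴱ)`. -/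
noncomputable def bbL {k m : ℕ} (x : Fin k → Fin m → ℝ) (n y : Fin k → ℕ)
    (r : ℝ) (β : Fin m → ℝ) : ℝ :=
  ∏ j : Fin k,
    ((n j).choose (y j) : ℝ) *
      betaFn ((y j : ℝ) + r * pE x j β) (((n j : ℝ) - (y j : ℝ)) + r * (1 - pE x j β)) /
      betaFn (r * pE x j β) (r * (1 - pE x j β))

theorem betaFn_eq_Gamma {a b : ℝ} (ha : 0 < a) (hb : 0 < b) :
    betaFn a b = Gamma a * Gamma b / Gamma (a + b) := by
  have h := ProbabilityTheory.beta_eq_betaIntegralReal a b ha hb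
  rw [ProbabilityTheory.beta] at h
  rw [h, betaFn, Complex.betaIntegral, ← Complex.ofReal_re (∫ v in (0:ℝ)..1, _),
    ← intervalIntegral.integral_ofReal]
  congr 1
  refine intervalIntegral.integral_congr fun v hv => ?_
  rw [Set.uIcc_of_le zero_le_one] at hv
  push_cast [Complex.ofReal_cpow hv.1, Complex.ofReal_cpow (sub_nonneg.2 hv.2)]
  rfl

theorem Gamma_add_natCast_eq_prod {a : ℝ} (ha : 0 < a) (s : ℕ) :
    Gamma (s + a) = (∏ i ∈ range s, (a + i)) * Gamma a := by
  induction s with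
  | zero => simp
  | succ s ih =>
    have h : ((s + 1 : ℕ) : ℝ) + a = (s + a) + 1 := by push_cast; ring
    rw [h, Gamma_add_one (by positivity), ih, prod_range_succ]
    ring

theorem betaFn_ratio {a b : ℝ} (ha : 0 < a) (hb : 0 < b) (s t : ℕ) :
    betaFn (s + a) (t + b) / betaFn a b =
      (∏ i ∈ range s, (a + i)) * (∏ i ∈ range t, (b + i)) /
        ∏ i ∈ range (s + t), (a + b + i) := by
  have hsum : (s + a) + (t + b) = ((s + t : ℕ) : ℝ) + (a + b) := by push_cast; ring
  rw [betaFn_eq_Gamma (by positivity) (by positivity), betaFn_eq_Gamma ha hb, hsum,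
    Gamma_add_natCast_eq_prod ha, Gamma_add_natCast_eq_prod hb,
    Gamma_add_natCast_eq_prod (add_pos ha hb)]
  have h1 := Gamma_pos_of_pos ha
  have h2 := Gamma_pos_of_pos hb
  have h3 := Gamma_pos_of_pos (add_pos ha hb)
  have h4 : 0 < ∏ i ∈ range (s + t), (a + b + i) := prod_pos fun i _ => by positivity
  field_simp

theorem prod_add_mul_prod_add_le {a b c : ℝ} (ha : 0 ≤ a) (hb : 0 ≤ b) (hac : a ≤ c)
    (hbc : b ≤ c) (s t : ℕ) :
    (∏ i ∈ range s, (a + i)) * ∏ i ∈ range t, (b + i) ≤ ∏ i ∈ range (s + t), (c + i) := by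
  rw [prod_range_add]
  refine mul_le_mul (prod_le_prod (fun i _ => by positivity) fun i _ => by gcongr)
    (prod_le_prod (fun i _ => by positivity) fun i _ => ?_)
    (prod_nonneg fun i _ => by positivity)
    (prod_nonneg fun i _ => add_nonneg (ha.trans hac) i.cast_nonneg)
  push_cast
  have : (0:ℝ) ≤ s := s.cast_nonneg
  linarith

theorem betaFn_ratio_nonneg {a b : ℝ} (ha : 0 < a) (hb : 0 < b) (s t : ℕ) :
    0 ≤ betaFn (s + a) (t + b) / betaFn a b := by
  rw [betaFn_ratio ha hb]
  positivity

theorem betaFn_ratio_le_one {a b : ℝ} (ha : 0 < a) (hb : 0 < b) (s t : ℕ) :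
    betaFn (s + a) (t + b) / betaFn a b ≤ 1 := by
  rw [betaFn_ratio ha hb]
  exact div_le_one_of_le₀
    (prod_add_mul_prod_add_le ha.le hb.le (by linarith) (by linarith) s t) (by positivity)

theorem betaFn_ratio_succ_succ_le {a b : ℝ} (ha : 0 < a) (hb : 0 < b) (s t : ℕ) :
    betaFn ((s + 1 : ℕ) + a) ((t + 1 : ℕ) + b) / betaFn a b ≤
      a * b / ((a + b) * (1 + (a + b))) := by
  have key := prod_add_mul_prod_add_le (a := a + 1) (b := b + 1) (c := a + b + 1)
    (by positivity) (by positivity) (by linarith) (by linarith) s t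
  have shift (z : ℝ) (l : ℕ) :
      ∏ i ∈ range (l + 1), (z + i) = z * ∏ i ∈ range l, (z + 1 + i) := by
    rw [prod_range_succ', mul_comm]
    simp [add_assoc, add_comm (1 : ℝ)]
  rw [betaFn_ratio ha hb, show s + 1 + (t + 1) = s + t + 1 + 1 by ring, shift a, shift b,
    shift (a + b), prod_range_succ, div_le_div_iff₀ (by positivity) (by positivity)]
  have hl : 1 + (a + b) ≤ a + b + 1 + (s + t : ℕ) := by
    have : (0:ℝ) ≤ (s + t : ℕ) := Nat.cast_nonneg _
    linarith
  have hmul := mul_le_mul key hl (by positivity) (by positivity)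
  calc _ = a * b * (a + b) * ((∏ i ∈ range s, (a + 1 + i)) * (∏ i ∈ range t, (b + 1 + i)) *
          (1 + (a + b))) := by ring
    _ ≤ a * b * (a + b) * ((∏ i ∈ range (s + t), (a + b + 1 + i)) *
          (a + b + 1 + (s + t : ℕ))) := by gcongr
    _ = _ := by ring

theorem logistic_pos (t : ℝ) : 0 < logistic t := by
  unfold logistic; positivity

theorem one_sub_logistic (t : ℝ) : 1 - logistic t = 1 / (1 + exp t) := by
  have : 0 < 1 + exp t := by positivity
  unfold logistic
  field_simp
  ring

theorem logistic_lt_one (t : ℝ) : logistic t < 1 := by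
  have h := one_sub_logistic t
  have : 0 < 1 / (1 + exp t) := by positivity
  linarith

theorem logistic_mul_one_sub_le (t : ℝ) : logistic t * (1 - logistic t) ≤ exp (-|t|) := by
  rw [one_sub_logistic, logistic, div_mul_div_comm, mul_one, div_le_iff₀ (by positivity)]
  have h0 := exp_pos t
  rcases le_total 0 t with ht | ht
  · have h1 : exp (-t) * exp t = 1 := by rw [← exp_add]; simp
    rw [abs_of_nonneg ht]
    have h2 := exp_pos (-t)
    nlinarith
  · rw [abs_of_nonpos ht, neg_neg]
    nlinarith [sq_nonneg (exp t)]

theorem integrable_exp_neg_mul_norm {E : Type*} [NormedAddCommGroup E] [NormedSpace ℝ E]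
    [FiniteDimensional ℝ E] [MeasurableSpace E] [BorelSpace E] (μ : Measure E)
    [μ.IsAddHaarMeasure] {c : ℝ} (hc : 0 < c) : Integrable (fun v => exp (-(c * ‖v‖))) μ := by
  set N := Module.finrank ℝ E + 1 with hN
  have hint : Integrable (fun v : E => (1 + ‖v‖) ^ (-(N : ℝ))) μ :=
    integrable_one_add_norm (by simp [hN])
  refine (hint.const_mul (N.factorial * exp c / c ^ N)).mono'
    (by fun_prop) (ae_of_all _ fun v => ?_)
  have hv : 0 < 1 + ‖v‖ := by positivity
  have h := pow_div_factorial_le_exp (c * (1 + ‖v‖)) (by positivity) N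
  rw [norm_of_nonneg (exp_pos _).le, rpow_neg hv.le, rpow_natCast, exp_neg, ← div_eq_mul_inv,
    div_div, inv_eq_one_div, div_le_div_iff₀ (exp_pos _) (by positivity), one_mul]
  rw [div_le_iff₀ (by positivity), mul_pow, mul_add, mul_one, exp_add] at h
  linarith

theorem Matrix.exists_norm_le_sum_abs_mulVec {ι : Type*} [Fintype ι] {m : ℕ}
    (A : Matrix ι (Fin m) ℝ) (hA : A.rank = m) :
    ∃ c > 0, ∀ v, c * ‖v‖ ≤ ∑ j, |A.mulVec v j| := by
  have hker : LinearMap.ker A.mulVecLin = ⊥ := by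
    have h := LinearMap.finrank_range_add_finrank_ker A.mulVecLin
    rw [Module.finrank_fin_fun] at h
    change A.rank + _ = m at h
    exact Submodule.finrank_eq_zero.1 (by omega)
  obtain ⟨K, hK, hanti⟩ := A.mulVecLin.exists_antilipschitzWith hker
  refine ⟨(K : ℝ)⁻¹, by positivity, fun v => ?_⟩
  have h := hanti.le_mul_dist v 0
  simp only [map_zero, dist_zero_right] at h
  rw [inv_mul_le_iff₀ (by positivity)]
  refine h.trans ?_
  gcongr
  refine (pi_norm_le_iff_of_nonneg (by positivity)).2 fun j => ?_
  exact single_le_sum (f := fun j => |A.mulVec v j|) (fun _ _ => abs_nonneg _) (mem_univ j)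

theorem rpow_mul_div_one_add_pow_le {r u : ℝ} (hr : 0 < r) {l : ℕ} (hl : u + 1 ≤ l) :
    r ^ (-(u + 1)) * (r / (1 + r)) ^ l ≤ (1 + ‖r‖) ^ (-(u + 1)) := by
  have h1 : (r / (1 + r)) ^ l ≤ (r / (1 + r)) ^ (u + 1) := by
    rw [← rpow_natCast]
    exact rpow_le_rpow_of_exponent_ge (by positivity)
      ((div_le_one (by positivity)).2 (by linarith)) hl
  rw [norm_of_nonneg hr.le]
  calc _ ≤ r ^ (-(u + 1)) * (r / (1 + r)) ^ (u + 1) := by gcongr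
    _ = _ := by
      rw [div_rpow hr.le (by positivity), rpow_neg hr.le, rpow_neg (by positivity)]
      have := rpow_pos_of_pos hr (u + 1)
      field_simp

theorem bbL_le {k m : ℕ} (x : Fin k → Fin m → ℝ) (n y : Fin k → ℕ) (hy : ∀ j, y j ≤ n j)
    {r : ℝ} (hr : 0 < r) (β : Fin m → ℝ) :
    bbL x n y r β ≤ (∏ j, ((n j).choose (y j) : ℝ)) *
      ∏ j with 1 ≤ y j ∧ y j ≤ n j - 1, r / (1 + r) * exp (-|∑ i, x j i * β i|) := by
  rw [prod_filter, ← prod_mul_distrib]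
  have hp (j) : 0 < pE x j β := logistic_pos _
  have hq (j) : 0 < 1 - pE x j β := sub_pos.2 (logistic_lt_one _)
  have hsub (j) : (n j : ℝ) - y j = (n j - y j : ℕ) := (Nat.cast_sub (hy j)).symm
  refine prod_le_prod (fun j _ => ?_) fun j _ => ?_ <;> rw [mul_div_assoc, hsub]
  · exact mul_nonneg (Nat.cast_nonneg _)
      (betaFn_ratio_nonneg (mul_pos hr (hp j)) (mul_pos hr (hq j)) _ _)
  refine mul_le_mul_of_nonneg_left ?_ (Nat.cast_nonneg _)
  split_ifs with hj
  · obtain ⟨s, hs⟩ := Nat.exists_eq_add_of_le' hj.1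
    obtain ⟨t, ht⟩ := Nat.exists_eq_add_of_le' (show 1 ≤ n j - y j by omega)
    rw [hs] at ht ⊢
    rw [ht]
    refine (betaFn_ratio_succ_succ_le (mul_pos hr (hp j)) (mul_pos hr (hq j)) s t).trans ?_
    have hsum : r * pE x j β + r * (1 - pE x j β) = r := by ring
    rw [hsum]
    calc _ = r / (1 + r) * (pE x j β * (1 - pE x j β)) := by field_simp
      _ ≤ _ := by
        gcongr
        exact logistic_mul_one_sub_le _
  · exact betaFn_ratio_le_one (mul_pos hr (hp j)) (mul_pos hr (hq j)) _ _

/-- Theorem 3 (sufficiency) + Corollary 1: at least one interior group, fully improper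
hyper-prior `dβ dr/r^{u+1}`, with `k_y ≥ u + 1` and `rank(X_y) = m`. Then the posterior
is proper. -/
theorem posterior_proper_fully_improper_mixed (k m : ℕ) (x : Fin k → Fin m → ℝ)
    (n y : Fin k → ℕ) (hn : ∀ j, 1 ≤ n j) (hy : ∀ j, y j ≤ n j)
    (hky : 1 ≤ (Finset.univ.filter fun j => 1 ≤ y j ∧ y j ≤ n j - 1).card)
    (u : ℝ) (hu : 0 < u)
    (hk : u + 1 ≤ ((Finset.univ.filter fun j => 1 ≤ y j ∧ y j ≤ n j - 1).card : ℝ))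
    (hrank :
      (Matrix.of fun j : {j : Fin k // 1 ≤ y j ∧ y j ≤ n j - 1} => x j.1).rank = m) :
    (∫⁻ β : Fin m → ℝ, ∫⁻ r in Set.Ioi (0:ℝ),
        ENNReal.ofReal (r ^ (-(u + 1)) * bbL x n y r β)) < ⊤ := by
  obtain ⟨c, hc, hcX⟩ := Matrix.exists_norm_le_sum_abs_mulVec _ hrank
  set C : ℝ := ∏ j, ((n j).choose (y j) : ℝ)
  have hC0 : 0 ≤ C := prod_nonneg fun j _ => Nat.cast_nonneg _
  have hbound (β : Fin m → ℝ) (r : ℝ) (hr : 0 < r) :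
      r ^ (-(u + 1)) * bbL x n y r β ≤
        C * exp (-(c * ‖β‖)) * (1 + ‖r‖) ^ (-(u + 1)) := by
    have hexp : ∏ j with 1 ≤ y j ∧ y j ≤ n j - 1, exp (-|∑ i, x j i * β i|) ≤
        exp (-(c * ‖β‖)) := by
      rw [← exp_sum, exp_le_exp, sum_neg_distrib, neg_le_neg_iff]
      refine (hcX β).trans_eq ?_
      exact (sum_subtype _ (by simp) fun j => |∑ i, x j i * β i|).symm
    have hL := bbL_le x n y hy hr β
    rw [prod_mul_distrib, prod_const] at hL
    calc _ ≤ r ^ (-(u + 1)) * (C * ((r / (1 + r)) ^ _ * exp (-(c * ‖β‖)))) := by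
          refine mul_le_mul_of_nonneg_left (hL.trans ?_) (by positivity)
          gcongr
      _ = C * exp (-(c * ‖β‖)) * (r ^ (-(u + 1)) * (r / (1 + r)) ^ _) := by ring
      _ ≤ _ := by
          gcongr
          exact rpow_mul_div_one_add_pow_le hr hk
  have hr_int : ∫⁻ r : ℝ, ENNReal.ofReal ((1 + ‖r‖) ^ (-(u + 1))) < ⊤ :=
    (integrable_one_add_norm (by simpa using hu)).lintegral_lt_top
  have hβ_int : ∫⁻ β : Fin m → ℝ, ENNReal.ofReal (C * exp (-(c * ‖β‖))) < ⊤ :=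
    ((integrable_exp_neg_mul_norm volume hc).const_mul C).lintegral_lt_top
  calc _ ≤ ∫⁻ β : Fin m → ℝ, ENNReal.ofReal (C * exp (-(c * ‖β‖))) *
          ∫⁻ r : ℝ, ENNReal.ofReal ((1 + ‖r‖) ^ (-(u + 1))) := by
        refine lintegral_mono fun β => ?_
        rw [← lintegral_const_mul' _ _ ENNReal.ofReal_ne_top]
        refine (setLIntegral_mono' measurableSet_Ioi fun r hr => ?_).trans
          (setLIntegral_le_lintegral _ _)
        rw [← ENNReal.ofReal_mul (by positivity)]
        exact ENNReal.ofReal_le_ofReal (hbound β r hr)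
    _ < ⊤ := by
        rw [lintegral_mul_const' _ _ hr_int.ne]
        exact ENNReal.mul_lt_top hβ_int hr_int
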